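/- Let P = P_{n,r} be the poset of r-colored injective words and let S = {s_1 < ⋯ < s_k} ⊆ {1,…,n−1}. Then b_P(S ∪ {n}), the dimension of β_P(S ∪ {n}), is equal to the number of pairs (w,u) where w ∈ 𝔖_n has descent set S, u is an r-colored permutation in 𝔖_n[ℤ_r], and τ(w,u) is even. -/

import Mathlib

open scoped Classical

noncomputable section

/-! ### Permutation combinatorics -/

/-- The value `w(i)` (1-based, in `{1,…,n}`) of a permutation `w` of `{1,…,n}`,
realized as `Equiv.Perm (Fin n)`. -/
def permApp {n : ℕ} (w : Equiv.Perm (Fin n)) (i : ℕ) : ℕ :=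
  if h : i - 1 < n then (w ⟨i - 1, h⟩ : ℕ) + 1 else 0

/-- The descent set of a permutation, a subset of `{1,…,n-1}`. -/
def descentSet {n : ℕ} (w : Equiv.Perm (Fin n)) : Finset ℕ :=
  (Finset.Icc 1 (n - 1)).filter fun i => permApp w (i + 1) < permApp w i

/-- `numDescentSet m T` is the number of permutations in `𝔖_m` with descent set `T`. -/
def numDescentSet (m : ℕ) (T : Finset ℕ) : ℕ :=
  Nat.card {w : Equiv.Perm (Fin m) // descentSet w = T}

/-- The Coxeter length (number of inversions) of a permutation. -/
def invCount {n : ℕ} (w : Equiv.Perm (Fin n)) : ℕ :=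
  (Finset.univ.filter fun p : Fin n × Fin n => p.1 < p.2 ∧ w p.2 < w p.1).card

/-- For `S = {s_1 < s_2 < ⋯ < s_k} ⊆ {1,…,n-1}`, `sElt n S j = s_j`, with the
conventions `s_0 = 0` and `s_j = n` for `j > k`. -/
def sElt (n : ℕ) (S : Finset ℕ) (j : ℕ) : ℕ :=
  if j = 0 then 0 else if j ≤ S.card then (S.sort (· ≤ ·)).getD (j - 1) 0 else n

lemma sElt_of_gt (n : ℕ) (S : Finset ℕ) (j : ℕ) (h : S.card < j) : sElt n S j = n := by
  unfold sElt
  rw [if_neg (by omega), if_neg (by omega)]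

/-! ### Standard Young tableaux -/

/-- A standard Young tableau of shape `μ`: a filling of the cells of `μ` by the numbers
`1,…,μ.card`, each used once, strictly increasing along rows and columns
(the entry of a non-cell is `0`). -/
structure SYT (μ : YoungDiagram) where
  entry : ℕ → ℕ → ℕ
  entry_eq_zero : ∀ i j, (i, j) ∉ μ → entry i j = 0
  row_strict : ∀ i j1 j2, j1 < j2 → (i, j2) ∈ μ → entry i j1 < entry i j2
  col_strict : ∀ i1 i2 j, i1 < i2 → (i2, j) ∈ μ → entry i1 j < entry i2 j
  bijOn : Set.BijOn (fun p : ℕ × ℕ => entry p.1 p.2) ↑μ.cells ↑(Finset.Icc 1 μ.card)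

/-- The descent set of a standard Young tableau: those `k` such that `k+1` lies in a
strictly lower row than `k`. -/
def SYT.des {μ : YoungDiagram} (Q : SYT μ) : Finset ℕ :=
  (Finset.Icc 1 (μ.card - 1)).filter fun k =>
    ∃ p1 ∈ μ.cells, ∃ p2 ∈ μ.cells,
      Q.entry p1.1 p1.2 = k ∧ Q.entry p2.1 p2.2 = k + 1 ∧ p1.1 < p2.1

/-- `fSYTRow μ t` is the number of standard Young tableaux of shape `μ` whose first row
contains the numbers `1,…,t`. -/
def fSYTRow (μ : YoungDiagram) (t : ℕ) : ℕ :=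
  Nat.card {Q : SYT μ // ∀ k, 1 ≤ k → k ≤ t → ∃ j, (0, j) ∈ μ ∧ Q.entry 0 j = k}

/-! ### Irreducible characters of the symmetric group, via Jacobi–Trudi -/

/-- The number of functions `f : Fin n → Fin k` which are invariant under `g` and whose
fiber over `i` has `c i` elements.  For `c` a composition of `n`, the function
`g ↦ fixedYoungFns n k c g` is the character of the permutation representation of `𝔖_n`
on ordered set partitions of `{1,…,n}` of type `c`, i.e. of the representation induced
from the trivial representation of the corresponding Young subgroup. -/
def fixedYoungFns (n k : ℕ) (c : Fin k → ℤ) (g : Equiv.Perm (Fin n)) : ℕ :=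
  Nat.card {f : Fin n → Fin k //
    (∀ x, f (g x) = f x) ∧ ∀ i, ((Nat.card {x : Fin n // f x = i} : ℕ) : ℤ) = c i}

/-- The irreducible character `χ^μ` of `𝔖_n` associated to a partition `μ` of `n`
(encoded as a Young diagram with `n` cells), defined through the Jacobi–Trudi
determinantal formula `χ^μ = det (h_{μ_i - i + j})`. -/
def chi (n : ℕ) (μ : YoungDiagram) (g : Equiv.Perm (Fin n)) : ℤ :=
  ∑ σ : Equiv.Perm (Fin μ.rowLens.length),
    ((Equiv.Perm.sign σ : ℤˣ) : ℤ) *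
      (fixedYoungFns n μ.rowLens.length
        (fun i => ((μ.rowLen (i : ℕ) : ℕ) : ℤ) - ((i : ℕ) : ℤ) + ((σ i : ℕ) : ℤ)) g : ℤ)

/-! ### Posets, rank selection, maximal chains and characters -/

/-- The maximal chains of the subposet induced on a subset `A` of a poset. -/
def maxChainsIn {P : Type*} [Preorder P] (A : Set P) : Set (Set P) :=
  {C | C ⊆ A ∧ IsChain (· ≤ ·) C ∧
    ∀ D : Set P, D ⊆ A → IsChain (· ≤ ·) D → C ⊆ D → C = D}

/-- The rank-selected subposet `P_S = {x ∈ P : rk x ∈ S} ∪ {⊥, ⊤}`. -/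
def rankSel {P : Type*} [Preorder P] [OrderBot P] [OrderTop P] (rk : P → ℕ)
    (S : Finset ℕ) : Set P :=
  {x | rk x ∈ S} ∪ {⊥, ⊤}

/-- `a_P(S)`: the number of maximal chains of the rank-selected subposet `P_S`. -/
def chainCount {P : Type*} [Preorder P] [OrderBot P] [OrderTop P] (rk : P → ℕ)
    (S : Finset ℕ) : ℕ :=
  Set.ncard (maxChainsIn (rankSel rk S))

/-- `b_P(S) = Σ_{T ⊆ S} (-1)^{|S-T|} a_P(T)`. -/
def bDim {P : Type*} [Preorder P] [OrderBot P] [OrderTop P] (rk : P → ℕ)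
    (S : Finset ℕ) : ℤ :=
  ∑ T ∈ S.powerset, (-1 : ℤ) ^ (S.card - T.card) * (chainCount rk T : ℤ)

/-- The character of the permutation representation `α_P(S)` of a group `G` acting (via
`act`) on the maximal chains of the rank-selected subposet `P_S`: its value at `g` is
the number of maximal chains of `P_S` fixed by `g`. -/
def gAlpha {P G : Type*} [Preorder P] [OrderBot P] [OrderTop P] (rk : P → ℕ)
    (act : G → P → P) (S : Finset ℕ) (g : G) : ℤ :=
  (Set.ncard {C : Set P | C ∈ maxChainsIn (rankSel rk S) ∧ act g '' C = C} : ℤ)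

/-- The character of the virtual representation
`β_P(S) = Σ_{T ⊆ S} (-1)^{|S-T|} α_P(T)`. -/
def gBeta {P G : Type*} [Preorder P] [OrderBot P] [OrderTop P] (rk : P → ℕ)
    (act : G → P → P) (S : Finset ℕ) (g : G) : ℤ :=
  ∑ T ∈ S.powerset, (-1 : ℤ) ^ (S.card - T.card) * gAlpha rk act T g

/-! ### The poset of injective words -/

/-- An injective word over the alphabet `{1,…,n}`. -/
def InjWord (n : ℕ) : Type := {l : List (Fin n) // l.Nodup}

instance (n : ℕ) : PartialOrder (InjWord n) where
  le u v := u.1.Sublist v.1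
  le_refl u := List.Sublist.refl _
  le_trans u v w h1 h2 := List.Sublist.trans h1 h2
  le_antisymm u v h1 h2 := Subtype.ext (List.Sublist.antisymm h1 h2)

instance (n : ℕ) : OrderBot (InjWord n) where
  bot := ⟨[], List.nodup_nil⟩
  bot_le u := List.nil_sublist u.1

/-- The rank function of the poset of injective words (with a maximum adjoined):
the rank of a word is its length, and the rank of `⊤` is `n+1`. -/
def rkInj (n : ℕ) (x : WithTop (InjWord n)) : ℕ :=
  WithTop.recTopCoe (n + 1) (fun u => u.1.length) x

/-- The action of `𝔖_n` on injective words, letter by letter. -/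
def permWord {n : ℕ} (w : Equiv.Perm (Fin n)) (u : InjWord n) : InjWord n :=
  ⟨u.1.map w, u.2.map w.injective⟩

/-- The character of `α_{P_n}(S)` for the `𝔖_n`-action on the poset of injective words. -/
def injAlpha (n : ℕ) (S : Finset ℕ) (g : Equiv.Perm (Fin n)) : ℤ :=
  gAlpha (rkInj n) (fun w : Equiv.Perm (Fin n) => WithTop.map (permWord w)) S g

/-- The character of `β_{P_n}(S)` for the `𝔖_n`-action on the poset of injective words. -/
def injBeta (n : ℕ) (S : Finset ℕ) (g : Equiv.Perm (Fin n)) : ℤ :=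
  gBeta (rkInj n) (fun w : Equiv.Perm (Fin n) => WithTop.map (permWord w)) S g

/-! ### The poset of r-colored injective words -/

/-- An `r`-colored injective word over `{1,…,n}`: a word in the alphabet
`{1,…,n} × ℤ_r` whose letters have pairwise distinct first coordinates. -/
def CInjWord (n r : ℕ) : Type := {l : List (Fin n × ZMod r) // (l.map Prod.fst).Nodup}

instance (n r : ℕ) : PartialOrder (CInjWord n r) where
  le u v := u.1.Sublist v.1
  le_refl u := List.Sublist.refl _
  le_trans u v w h1 h2 := List.Sublist.trans h1 h2
  le_antisymm u v h1 h2 := Subtype.ext (List.Sublist.antisymm h1 h2)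

instance (n r : ℕ) : OrderBot (CInjWord n r) where
  bot := ⟨[], by simp⟩
  bot_le u := List.nil_sublist u.1

/-- The rank function of the poset `P_{n,r}` of `r`-colored injective words
(with a maximum adjoined). -/
def rkC (n r : ℕ) (x : WithTop (CInjWord n r)) : ℕ :=
  WithTop.recTopCoe (n + 1) (fun u => u.1.length) x

/-- The action of `𝔖_n` on `r`-colored injective words: act on the first coordinate
of each letter, leaving colors unchanged. -/
def permCWord {n r : ℕ} (w : Equiv.Perm (Fin n)) (u : CInjWord n r) : CInjWord n r :=
  ⟨u.1.map (fun p => (w p.1, p.2)), by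
    have h := u.2.map w.injective
    rw [List.map_map] at h ⊢
    exact h⟩

/-- The character of `α_{P_{n,r}}(S)`. -/
def cAlpha (n r : ℕ) (S : Finset ℕ) (g : Equiv.Perm (Fin n)) : ℤ :=
  gAlpha (rkC n r) (fun w : Equiv.Perm (Fin n) => WithTop.map (permCWord w)) S g

/-- The character of `β_{P_{n,r}}(S)`. -/
def cBeta (n r : ℕ) (S : Finset ℕ) (g : Equiv.Perm (Fin n)) : ℤ :=
  gBeta (rkC n r) (fun w : Equiv.Perm (Fin n) => WithTop.map (permCWord w)) S g

/-- `b_{P_{n,r}}(S)`, the dimension of `β_{P_{n,r}}(S)`. -/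
def cChainDim (n r : ℕ) (S : Finset ℕ) : ℤ := bDim (rkC n r) S

/-! ### The statistics τ -/

/-- `τ(w,Q)` for a permutation `w` with descent set `S = {s_1 < ⋯ < s_k}` and a standard
Young tableau `Q`: the largest `i ∈ {0,…,k+1}` such that (a) `w(x) = w_S(x)` for
`x > s_{k+1-i}` and (b) no descent of `Q` is smaller than `n - s_{k+1-i}`. -/
def tau (n : ℕ) (S : Finset ℕ) (wS w : Equiv.Perm (Fin n)) {μ : YoungDiagram}
    (Q : SYT μ) : ℕ :=
  ((Finset.range (S.card + 2)).filter
    (fun i => (∀ x, sElt n S (S.card + 1 - i) < x → x ≤ n → permApp w x = permApp wS x) ∧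
      (∀ d ∈ Q.des, n - sElt n S (S.card + 1 - i) ≤ d))).max'
    ⟨0, by
      have hs := sElt_of_gt n S (S.card + 1 - 0) (by omega)
      refine Finset.mem_filter.2 ⟨Finset.mem_range.2 (by omega), ?_, ?_⟩
      · intro x hx hx'
        rw [hs] at hx
        exact absurd hx (not_lt.2 hx')
      · intro d _
        rw [hs]
        omega⟩

/-- The condition that all the numbers `1,…,t` appear in the first row of the `r`-colored
standard Young tableau `(Q, c)` and are colored with the zero color (the color of the
entry `k` being `c (k-1)`). -/
def zeroFirstRow {μ : YoungDiagram} {r : ℕ} (Q : SYT μ) (c : Fin μ.card → ZMod r)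
    (t : ℕ) : Prop :=
  ∀ k : Fin μ.card, (k : ℕ) < t →
    ((∃ j, (0, j) ∈ μ ∧ Q.entry 0 j = (k : ℕ) + 1) ∧ c k = 0)

/-- `τ(w,Q)` for an `r`-colored standard Young tableau `(Q,c)`. -/
def ctau (n : ℕ) {r : ℕ} (S : Finset ℕ) (wS w : Equiv.Perm (Fin n)) {μ : YoungDiagram}
    (Q : SYT μ) (c : Fin μ.card → ZMod r) : ℕ :=
  ((Finset.range (S.card + 2)).filter
    (fun i => (∀ x, sElt n S (S.card + 1 - i) < x → x ≤ n → permApp w x = permApp wS x) ∧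
      zeroFirstRow Q c (n - sElt n S (S.card + 1 - i)))).max'
    ⟨0, by
      have hs := sElt_of_gt n S (S.card + 1 - 0) (by omega)
      refine Finset.mem_filter.2 ⟨Finset.mem_range.2 (by omega), ?_, ?_⟩
      · intro x hx hx'
        rw [hs] at hx
        exact absurd hx (not_lt.2 hx')
      · rw [hs]
        intro k hk
        exact absurd hk (by omega)⟩

/-- The largest `i ∈ {0,…,n}` such that all the numbers `1,…,i` appear in the first row
of the `r`-colored standard Young tableau `(Q,c)` and are colored with the zero color. -/
def mQ (n : ℕ) {r : ℕ} {μ : YoungDiagram} (Q : SYT μ) (c : Fin μ.card → ZMod r) : ℕ :=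
  ((Finset.range (n + 1)).filter (fun i => zeroFirstRow Q c i)).max'
    ⟨0, Finset.mem_filter.2 ⟨Finset.mem_range.2 (by omega),
      fun k hk => absurd hk (by omega)⟩⟩

/-- The condition, for an `r`-colored permutation `(π, c)` (the color of the entry
`π(x)` in one-line notation being `c (x-1)`), that the entries `π(1),…,π(t)` are in
increasing order and all colored with the zero color. -/
def zeroIncreasing {n r : ℕ} (π : Equiv.Perm (Fin n)) (c : Fin n → ZMod r) (t : ℕ) : Prop :=
  (∀ x y, 1 ≤ x → x < y → y ≤ t → permApp π x < permApp π y) ∧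
  ∀ k : Fin n, (k : ℕ) < t → c k = 0

/-- `τ(w,u)` for an `r`-colored permutation `u = (π, c)`. -/
def tauU (n : ℕ) {r : ℕ} (S : Finset ℕ) (wS w : Equiv.Perm (Fin n))
    (π : Equiv.Perm (Fin n)) (c : Fin n → ZMod r) : ℕ :=
  ((Finset.range (S.card + 2)).filter
    (fun i => (∀ x, sElt n S (S.card + 1 - i) < x → x ≤ n → permApp w x = permApp wS x) ∧
      zeroIncreasing π c (n - sElt n S (S.card + 1 - i)))).max'
    ⟨0, by
      have hs := sElt_of_gt n S (S.card + 1 - 0) (by omega)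
      refine Finset.mem_filter.2 ⟨Finset.mem_range.2 (by omega), ?_, ?_, ?_⟩
      · intro x hx hx'
        rw [hs] at hx
        exact absurd hx (not_lt.2 hx')
      · intro x y hx hxy hy
        rw [hs] at hy
        exact absurd hy (by omega)
      · rw [hs]
        intro k hk
        exact absurd hk (by omega)⟩

/-- The largest `i ∈ {0,…,n}` such that the entries `π(1),…,π(i)` of the `r`-colored
permutation `(π,c)` are in increasing order and all colored with the zero color. -/
def mU (n : ℕ) {r : ℕ} (π : Equiv.Perm (Fin n)) (c : Fin n → ZMod r) : ℕ :=
  ((Finset.range (n + 1)).filter (fun i => zeroIncreasing π c i)).max'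
    ⟨0, Finset.mem_filter.2 ⟨Finset.mem_range.2 (by omega),
      fun x y hx hxy hy => absurd hy (by omega),
      fun k hk => absurd hk (by omega)⟩⟩

/-- `a_m(T)`: the number of chains in the Boolean lattice `B_m` whose elements have
set of ranks (cardinalities) equal to `T`. -/
def boolChains (m : ℕ) (T : Finset ℕ) : ℕ :=
  Nat.card {c : Finset (Finset (Fin m)) //
    IsChain (· ⊆ ·) (↑c : Set (Finset (Fin m))) ∧ c.image Finset.card = T}

end


lemma sum_indicator_powerset (S : Finset ℕ) : ∀ U : Finset ℕ,
    ∑ T ∈ S.powerset, (-1 : ℤ) ^ (S.card - T.card) * (if U ⊆ T then 1 else 0) =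
      if U = S then 1 else 0 := by
  induction S using Finset.induction_on with
  | empty => intro U; rw [Finset.powerset_empty, Finset.sum_singleton]; simp [Finset.subset_empty]
  | insert a S ha ih =>
    intro U
    rw [Finset.sum_powerset_insert ha]
    have key : ∀ T ∈ S.powerset,
        (-1 : ℤ) ^ ((insert a S).card - T.card) * (if U ⊆ T then 1 else 0) +
        (-1 : ℤ) ^ ((insert a S).card - (insert a T).card) * (if U ⊆ insert a T then 1 else 0) =
        (-1 : ℤ) ^ (S.card - T.card) *
          (if a ∈ U then (if U.erase a ⊆ T then 1 else 0) else 0) := by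
      intro T hT
      have hT' := Finset.mem_powerset.1 hT
      have haT : a ∉ T := fun h => ha (hT' h)
      have hc := Finset.card_le_card hT'
      rw [Finset.card_insert_of_notMem ha, Finset.card_insert_of_notMem haT]
      have e1 : S.card + 1 - T.card = (S.card - T.card) + 1 := by omega
      have e2 : S.card + 1 - (T.card + 1) = S.card - T.card := by omega
      rw [e1, e2, pow_succ]
      by_cases haU : a ∈ U
      · have h1 : ¬ U ⊆ T := fun h => haT (h haU)
        have h2 : U ⊆ insert a T ↔ U.erase a ⊆ T := Finset.subset_insert_iff
        simp [h1, h2, haU]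
      · have h2 : U ⊆ insert a T ↔ U ⊆ T := by
          rw [Finset.subset_insert_iff, Finset.erase_eq_of_notMem haU]
        simp only [h2, haU, if_false]
        split_ifs <;> ring
    rw [← Finset.sum_add_distrib, Finset.sum_congr rfl key]
    by_cases haU : a ∈ U
    · simp only [haU, if_true]
      rw [ih]
      have : U.erase a = S ↔ U = insert a S := by
        constructor
        · rintro rfl; exact (Finset.insert_erase haU).symm
        · rintro rfl; exact Finset.erase_insert ha
      simp [this]
    · have : U ≠ insert a S := by rintro rfl; simp at haU
      simp [haU, this]

/-- number of permutations with descent set inside `T` -/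
noncomputable def numSub (m : ℕ) (T : Finset ℕ) : ℕ :=
  (Finset.univ.filter fun w : Equiv.Perm (Fin m) => descentSet w ⊆ T).card

/-- number of permutations with descent set `T` -/
noncomputable def numEq (m : ℕ) (T : Finset ℕ) : ℕ :=
  (Finset.univ.filter fun w : Equiv.Perm (Fin m) => descentSet w = T).card

lemma moebius_num (m : ℕ) (S : Finset ℕ) :
    ∑ T ∈ S.powerset, (-1 : ℤ) ^ (S.card - T.card) * (numSub m T : ℤ) = numEq m S := by
  unfold numSub numEq
  simp only [Finset.card_filter, Nat.cast_sum, Finset.mul_sum, Nat.cast_ite, Nat.cast_one,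
    Nat.cast_zero]
  rw [Finset.sum_comm]
  exact Finset.sum_congr rfl fun w _ => sum_indicator_powerset S (descentSet w)

lemma altSum_insert (g : Finset ℕ → ℤ) (t : ℕ) (S : Finset ℕ) (ht : t ∉ S) :
    ∑ T ∈ (insert t S).powerset, (-1 : ℤ) ^ ((insert t S).card - T.card) * g T =
    ∑ T ∈ S.powerset, (-1 : ℤ) ^ (S.card - T.card) * g (insert t T) -
    ∑ T ∈ S.powerset, (-1 : ℤ) ^ (S.card - T.card) * g T := by
  rw [Finset.sum_powerset_insert ht, ← Finset.sum_add_distrib, ← Finset.sum_sub_distrib]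
  refine Finset.sum_congr rfl fun T hT => ?_
  have hT' := Finset.mem_powerset.1 hT
  have haT : t ∉ T := fun h => ht (hT' h)
  have hc := Finset.card_le_card hT'
  rw [Finset.card_insert_of_notMem ht, Finset.card_insert_of_notMem haT]
  have e1 : S.card + 1 - T.card = (S.card - T.card) + 1 := by omega
  have e2 : S.card + 1 - (T.card + 1) = S.card - T.card := by omega
  rw [e1, e2, pow_succ]
  ring

lemma sort_insert_max (t : ℕ) (S : Finset ℕ) (ht : ∀ x ∈ S, x < t) :
    (insert t S).sort (· ≤ ·) = S.sort (· ≤ ·) ++ [t] := by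
  have hn : t ∉ S := fun h => lt_irrefl _ (ht t h)
  refine List.Perm.eq_of_pairwise (le := (· ≤ ·)) ?_ (Finset.pairwise_sort _ _) ?_ ?_
  · intro a b _ _ h1 h2; exact le_antisymm h1 h2
  · rw [List.pairwise_append]
    refine ⟨Finset.pairwise_sort _ _, by simp, ?_⟩
    intro a ha b hb
    simp at ha hb
    subst hb
    exact (ht a ha).le
  · rw [List.perm_ext_iff_of_nodup (Finset.sort_nodup _ _)]
    · intro a; simp [or_comm]
    · rw [List.nodup_append]
      refine ⟨Finset.sort_nodup _ _, by simp, ?_⟩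
      intro a ha b hb
      simp at ha hb
      subst hb
      exact (ht a ha).ne

lemma sElt_insert_max (n t : ℕ) (S : Finset ℕ) (ht : ∀ x ∈ S, x < t) (j : ℕ)
    (hj : j ≤ S.card + 1) : sElt n (insert t S) j = sElt t S j := by
  have hn : t ∉ S := fun h => lt_irrefl _ (ht t h)
  unfold sElt
  rw [Finset.card_insert_of_notMem hn, sort_insert_max t S ht]
  by_cases h0 : j = 0
  · simp [h0]
  by_cases h1 : j ≤ S.card
  · rw [if_neg h0, if_pos hj, if_neg h0, if_pos h1, List.getD_append]
    simp; omega
  · have : j = S.card + 1 := by omega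
    subst this
    simp

/-- Alternating sum -/
lemma bsum_eq (N : ℕ → ℤ) (β : ℕ → Finset ℕ → ℤ) (B : Finset ℕ → ℤ)
    (hN0 : N 0 = 1) (hβ0 : β 0 ∅ = 1) (hB0 : B ∅ = 1) (m : ℕ)
    (hB : ∀ t S, 0 < t → t ≤ m → (∀ x ∈ S, 0 < x ∧ x < t) →
      B (insert t S) = N t * β t S - B S) (S : Finset ℕ) :
    ∀ n, 0 < n → n ≤ m → (∀ x ∈ S, 0 < x ∧ x < n) →
    B (insert n S) = ∑ i ∈ Finset.range (S.card + 2), (-1 : ℤ) ^ i *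
      (N (sElt n S (S.card + 1 - i)) * β (sElt n S (S.card + 1 - i))
        (S.filter (· < sElt n S (S.card + 1 - i)))) := by
  induction S using Finset.induction_on_max with
  | empty =>
    intro n hn hm _
    rw [hB n ∅ hn hm (by simp), hB0]
    simp [Finset.sum_range_succ, sElt, hN0, hβ0]
    ring
  | insert t S ht ih =>
    intro n hn hm hS
    have hn' : t ∉ S := fun h => lt_irrefl _ (ht t h)
    have ht0 := hS t (by simp)
    rw [hB n _ hn hm hS, ih t ht0.1 (by omega)
      (fun x hx => ⟨(hS x (by simp [hx])).1, ht x hx⟩),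
      Finset.card_insert_of_notMem hn', Finset.sum_range_succ' _ (S.card + 2)]
    have e0 : sElt n (insert t S) (S.card + 1 + 1 - 0) = n :=
      sElt_of_gt _ _ _ (by rw [Finset.card_insert_of_notMem hn']; omega)
    rw [e0]
    have e1 : (insert t S).filter (· < n) = insert t S :=
      Finset.filter_true_of_mem fun x hx => (hS x hx).2
    rw [e1, pow_zero, one_mul, sub_eq_add_neg, add_comm, ← Finset.sum_neg_distrib]
    congr 1
    refine Finset.sum_congr rfl fun i hi => ?_
    have e2 : S.card + 1 + 1 - (i + 1) = S.card + 1 - i := by omega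
    have e3 : sElt n (insert t S) (S.card + 1 - i) = sElt t S (S.card + 1 - i) :=
      sElt_insert_max _ _ _ ht _ (by omega)
    have hle : sElt t S (S.card + 1 - i) ≤ t := by
      unfold sElt
      split_ifs with h0 h1
      · omega
      · rw [List.getD_eq_getElem _ _ (by simp; omega)]
        refine (ht _ ?_).le
        rw [← Finset.mem_sort (· ≤ ·)]
        exact List.getElem_mem _
      · exact le_refl t
    rw [e2, e3, Finset.filter_insert, if_neg (by omega), pow_succ]
    ring


lemma mem_descentSet {n : ℕ} (w : Equiv.Perm (Fin n)) (i : ℕ) :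
    i ∈ descentSet w ↔ ∃ (h : i < n) (_ : 0 < i), w ⟨i, h⟩ < w ⟨i - 1, by omega⟩ := by
  unfold descentSet permApp
  rw [Finset.mem_filter, Finset.mem_Icc]
  constructor
  · rintro ⟨⟨h1, h2⟩, h3⟩
    have h : i < n := by omega
    refine ⟨h, h1, ?_⟩
    rw [dif_pos (by omega), dif_pos (by omega)] at h3
    simpa using h3
  · rintro ⟨h, h0, h3⟩
    refine ⟨⟨h0, by omega⟩, ?_⟩
    rw [dif_pos (by omega), dif_pos (by omega)]
    simpa using h3

lemma descentSet_empty_iff {n : ℕ} (w : Equiv.Perm (Fin n)) : descentSet w = ∅ ↔ w = 1 := by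
  constructor
  · intro h
    have hm : ∀ i (hi : i < n), ∀ j (hj : j < i), w ⟨j, by omega⟩ < w ⟨i, hi⟩ := by
      intro i
      induction i with
      | zero => intro _ j hj; omega
      | succ i ih =>
        intro hi j hj
        have h1 : w ⟨i, by omega⟩ < w ⟨i + 1, hi⟩ := by
          by_contra hc
          have : i + 1 ∈ descentSet w := by
            rw [mem_descentSet]
            refine ⟨hi, by omega, lt_of_le_of_ne (not_lt.1 hc) ?_⟩
            intro he
            have := w.injective he
            simp at this
          rw [h] at this
          simp at this
        rcases Nat.lt_or_ge j i with h2 | h2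
        · exact (ih (by omega) j h2).trans h1
        · have : j = i := by omega
          subst this
          exact h1
    have hs : StrictMono (w : Fin n → Fin n) := fun a b hab => hm b.1 b.2 a.1 hab
    have := (StrictMono.range_inj hs (strictMono_id)).1 (by simp [w.surjective.range_eq])
    ext x
    simp [this]
  · rintro rfl
    ext i
    rw [mem_descentSet]
    simp
    

section glue
variable {t d : ℕ}

lemma compl_card_glue (A : {A : Finset (Fin (t + d)) // A.card = t}) : (A.1ᶜ).card = d := by
  rw [Finset.card_compl, A.2, Fintype.card_fin]; omega

noncomputable def glue (p : {A : Finset (Fin (t + d)) // A.card = t} ×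
    Equiv.Perm (Fin t) × Equiv.Perm (Fin d)) : Equiv.Perm (Fin (t + d)) :=
  finSumFinEquiv.symm.trans ((Equiv.sumCongr p.2.1 p.2.2).trans
    (finSumEquivOfFinset p.1.2 (compl_card_glue p.1)))

lemma glue_left (A : {A : Finset (Fin (t + d)) // A.card = t}) (v : Equiv.Perm (Fin t))
    (u : Equiv.Perm (Fin d)) (i : Fin t) :
    glue (A, v, u) (Fin.castAdd d i) = A.1.orderEmbOfFin A.2 (v i) := by
  simp [glue]

lemma glue_right (A : {A : Finset (Fin (t + d)) // A.card = t}) (v : Equiv.Perm (Fin t))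
    (u : Equiv.Perm (Fin d)) (i : Fin d) :
    glue (A, v, u) (Fin.natAdd t i) = A.1ᶜ.orderEmbOfFin (compl_card_glue A) (u i) := by
  simp [glue]

lemma glue_compl (A : {A : Finset (Fin (t + d)) // A.card = t}) (v : Equiv.Perm (Fin t))
    (u : Equiv.Perm (Fin d)) :
    A.1ᶜ = Finset.univ.image fun i : Fin d => glue (A, v, u) (Fin.natAdd t i) := by
  symm
  apply Finset.eq_of_subset_of_card_le
  · intro x hx
    obtain ⟨i, -, rfl⟩ := Finset.mem_image.1 hx
    rw [glue_right]
    exact Finset.orderEmbOfFin_mem _ _ _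
  · rw [compl_card_glue, Finset.card_image_of_injective]
    · simp
    · intro i j h
      simpa using h

lemma glue_bijective : Function.Bijective (glue (t := t) (d := d)) := by
  constructor
  · rintro ⟨A, v, u⟩ ⟨B, v', u'⟩ h
    have hAB : A = B := by
      apply Subtype.ext
      apply compl_injective
      rw [glue_compl A v u, glue_compl B v' u', h]
    subst hAB
    have h1 : v = v' := by
      ext i
      have := congrArg (fun w => w (Fin.castAdd d i)) h
      simp only [glue_left] at this
      rw [(A.1.orderEmbOfFin A.2).injective this]
    have h2 : u = u' := by
      ext i
      have := congrArg (fun w => w (Fin.natAdd t i)) h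
      simp only [glue_right] at this
      rw [(A.1ᶜ.orderEmbOfFin (compl_card_glue A)).injective this]
    rw [h1, h2]
  · intro w
    let A : {A : Finset (Fin (t + d)) // A.card = t} :=
      ⟨Finset.univ.image fun i : Fin t => w (Fin.castAdd d i), by
        rw [Finset.card_image_of_injective]
        · simp
        · intro i j h
          simpa using h⟩
    let σ : Equiv.Perm (Fin t ⊕ Fin d) :=
      finSumFinEquiv.trans (w.trans (finSumEquivOfFinset A.2 (compl_card_glue A)).symm)
    have hσ : σ ∈ (Equiv.Perm.sumCongrHom (Fin t) (Fin d)).range := by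
      apply Equiv.Perm.mem_sumCongrHom_range_of_perm_mapsTo_inl
      rintro _ ⟨i, rfl⟩
      have hm : w (Fin.castAdd d i) ∈ A.1 := Finset.mem_image.2 ⟨i, Finset.mem_univ _, rfl⟩
      have hm' : w (Fin.castAdd d i) ∈ Set.range (A.1.orderEmbOfFin A.2) := by
        rw [Finset.range_orderEmbOfFin]; exact hm
      obtain ⟨j, hj⟩ := hm'
      refine ⟨j, ?_⟩
      simp only [σ, Equiv.trans_apply, finSumFinEquiv_apply_left]
      rw [Equiv.eq_symm_apply, finSumEquivOfFinset_inl, hj]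
    obtain ⟨⟨v, u⟩, hvu⟩ := hσ
    refine ⟨(A, v, u), ?_⟩
    ext x : 1
    have := congrArg (fun e => finSumEquivOfFinset A.2 (compl_card_glue A)
      (e (finSumFinEquiv.symm x))) hvu
    simpa [σ, glue] using this

lemma mem_des_glue_left (A : {A : Finset (Fin (t + d)) // A.card = t}) (v : Equiv.Perm (Fin t))
    (u : Equiv.Perm (Fin d)) (i : ℕ) (hi : i < t) :
    i ∈ descentSet (glue (A, v, u)) ↔ i ∈ descentSet v := by
  rw [mem_descentSet, mem_descentSet]
  have e1 := glue_left A v u ⟨i, hi⟩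
  have e2 := glue_left A v u ⟨i - 1, by omega⟩
  constructor
  · rintro ⟨h, h0, h1⟩
    refine ⟨hi, h0, ?_⟩
    simp only [Fin.castAdd_mk] at e1 e2
    rw [e1, e2] at h1
    simpa using h1
  · rintro ⟨h, h0, h1⟩
    refine ⟨by omega, h0, ?_⟩
    simp only [Fin.castAdd_mk] at e1 e2
    rw [e1, e2]
    simpa using h1

lemma mem_des_glue_right (A : {A : Finset (Fin (t + d)) // A.card = t}) (v : Equiv.Perm (Fin t))
    (u : Equiv.Perm (Fin d)) (i : ℕ) (hi : 0 < i) :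
    t + i ∈ descentSet (glue (A, v, u)) ↔ i ∈ descentSet u := by
  rw [mem_descentSet, mem_descentSet]
  by_cases hid : i < d
  · have e1 := glue_right A v u ⟨i, hid⟩
    have e2 := glue_right A v u ⟨i - 1, by omega⟩
    simp only [Fin.natAdd_mk] at e1 e2
    have e3 : t + i - 1 = t + (i - 1) := by omega
    simp only [e3, e1, e2]
    simp [hi, hid]
  · constructor
    · rintro ⟨h, -⟩; omega
    · rintro ⟨h, -⟩; omega

lemma lt_of_mem_descentSet {n : ℕ} {w : Equiv.Perm (Fin n)} {i : ℕ} (h : i ∈ descentSet w) :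
    0 < i ∧ i < n := by
  rw [mem_descentSet] at h
  obtain ⟨h, h0, -⟩ := h
  exact ⟨h0, h⟩

lemma des_glue_subset (A : {A : Finset (Fin (t + d)) // A.card = t}) (v : Equiv.Perm (Fin t))
    (u : Equiv.Perm (Fin d)) (T : Finset ℕ) (hT : ∀ x ∈ T, x < t) :
    descentSet (glue (A, v, u)) ⊆ insert t T ↔ descentSet v ⊆ T ∧ u = 1 := by
  rw [← descentSet_empty_iff]
  constructor
  · intro h
    constructor
    · intro i hi
      have hit := (lt_of_mem_descentSet hi).2
      have := h ((mem_des_glue_left A v u i hit).2 hi)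
      rcases Finset.mem_insert.1 this with h1 | h1
      · omega
      · exact h1
    · rw [Finset.eq_empty_iff_forall_notMem]
      intro i hi
      have hi0 := (lt_of_mem_descentSet hi).1
      have := h ((mem_des_glue_right A v u i hi0).2 hi)
      rcases Finset.mem_insert.1 this with h1 | h1
      · omega
      · have := hT _ h1; omega
  · rintro ⟨h1, h2⟩ i hi
    rcases lt_trichotomy i t with h | h | h
    · exact Finset.mem_insert_of_mem (h1 ((mem_des_glue_left A v u i h).1 hi))
    · simp [h]
    · obtain ⟨j, rfl⟩ := Nat.exists_eq_add_of_lt h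
      have := (mem_des_glue_right A v u (j + 1) (by omega)).1 (by simpa [add_assoc] using hi)
      rw [h2] at this
      simp at this

lemma card_A : Fintype.card {A : Finset (Fin (t + d)) // A.card = t} = (t + d).choose t := by
  simp

lemma numSub_insert (T : Finset ℕ) (hT : ∀ x ∈ T, x < t) :
    numSub (t + d) (insert t T) = (t + d).choose t * numSub t T := by
  unfold numSub
  rw [← card_A, ← Finset.card_univ, ← Finset.card_product]
  symm
  refine Finset.card_bij (fun p _ => glue (p.1, p.2, 1)) ?_ ?_ ?_
  · rintro ⟨A, v⟩ h
    simp only [Finset.mem_product, Finset.mem_univ, Finset.mem_filter, true_and] at h ⊢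
    exact (des_glue_subset _ _ _ T hT).2 ⟨h, rfl⟩
  · rintro ⟨A, v⟩ _ ⟨B, v'⟩ _ h
    have := glue_bijective.1 h
    simp only [Prod.mk.injEq] at this
    simp [this.1, this.2.1]
  · intro w hw
    obtain ⟨⟨A, v, u⟩, rfl⟩ := glue_bijective.2 w
    simp only [Finset.mem_univ, Finset.mem_filter, true_and] at hw
    obtain ⟨h1, rfl⟩ := (des_glue_subset _ _ _ T hT).1 hw
    exact ⟨(A, v), by simp [h1], rfl⟩

lemma numSub_empty (m : ℕ) : numSub m ∅ = 1 := by
  unfold numSub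
  rw [Finset.card_eq_one]
  refine ⟨1, ?_⟩
  ext w
  simp [Finset.subset_empty, descentSet_empty_iff]

/-- permutations increasing on the first `t` positions -/
lemma card_increasing :
    (Finset.univ.filter fun w : Equiv.Perm (Fin (t + d)) =>
      ∀ x y, 1 ≤ x → x < y → y ≤ t → permApp w x < permApp w y).card =
    (t + d).choose t * d.factorial := by
  have : d.factorial = (Finset.univ : Finset (Equiv.Perm (Fin d))).card := by
    rw [Finset.card_univ, Fintype.card_perm, Fintype.card_fin]
  rw [this, ← card_A, ← Finset.card_univ, ← Finset.card_product]
  have key : ∀ A v u, (∀ x y, 1 ≤ x → x < y → y ≤ t →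
      permApp (glue (t := t) (d := d) (A, v, u)) x < permApp (glue (A, v, u)) y) ↔ v = 1 := by
    intro A v u
    have e : ∀ x, (h1 : 1 ≤ x) → (hx : x ≤ t) → permApp (glue (A, v, u)) x =
        (A.1.orderEmbOfFin A.2 (v ⟨x - 1, by omega⟩) : ℕ) + 1 := by
      intro x h1 hx
      rw [← glue_left A v u, permApp, dif_pos (by omega)]
      rfl
    constructor
    · intro h
      rw [← descentSet_empty_iff, Finset.eq_empty_iff_forall_notMem]
      intro i hi
      rw [mem_descentSet] at hi
      obtain ⟨hi, h0, hlt⟩ := hi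
      have := h i (i + 1) h0 (by omega) (by omega)
      rw [e _ (by omega) (by omega), e _ (by omega) (by omega)] at this
      simp only [add_lt_add_iff_right, Fin.val_fin_lt, OrderEmbedding.lt_iff_lt,
        Nat.add_sub_cancel] at this
      exact absurd this (not_lt.2 hlt.le)
    · rintro rfl x y h1 hxy hy
      rw [e _ (by omega) (by omega), e _ (by omega) (by omega)]
      simp only [add_lt_add_iff_right, Fin.val_fin_lt, OrderEmbedding.lt_iff_lt]
      simp
      omega
  symm
  refine Finset.card_bij (fun p _ => glue (p.1, 1, p.2)) ?_ ?_ ?_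
  · rintro ⟨A, v⟩ h
    simp only [Finset.mem_univ, Finset.mem_filter, true_and]
    exact (key _ _ _).2 rfl
  · rintro ⟨A, v⟩ _ ⟨B, v'⟩ _ h
    have := glue_bijective.1 h
    simp only [Prod.mk.injEq] at this
    simp [this.1, this.2.2]
  · intro w hw
    obtain ⟨⟨A, v, u⟩, rfl⟩ := glue_bijective.2 w
    simp only [Finset.mem_univ, Finset.mem_filter, true_and] at hw
    obtain rfl := (key _ _ _).1 hw
    exact ⟨(A, u), by simp, rfl⟩

/-- permutations that agree with a given one on a tail -/
lemma card_tail (wS : Equiv.Perm (Fin (t + d)))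
    (hw : ∀ i j : Fin (t + d), (i : ℕ) < t → t ≤ (j : ℕ) → wS j < wS i) :
    (Finset.univ.filter fun w : Equiv.Perm (Fin (t + d)) => descentSet w = descentSet wS ∧
      ∀ x, t < x → x ≤ t + d → permApp w x = permApp wS x).card =
    numEq t ((descentSet wS).filter (· < t)) := by
  obtain ⟨⟨A, v0, u⟩, rfl⟩ := glue_bijective.2 wS
  unfold numEq
  have hA : ∀ a ∈ A.1, ∀ b ∈ A.1ᶜ, b < a := by
    intro a ha b hb
    have ha' : a ∈ Set.range (A.1.orderEmbOfFin A.2) := by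
      rw [Finset.range_orderEmbOfFin]; exact ha
    obtain ⟨i, rfl⟩ := ha'
    rw [glue_compl A v0 u] at hb
    obtain ⟨j, -, rfl⟩ := Finset.mem_image.1 hb
    have := hw (Fin.castAdd d (v0.symm i)) (Fin.natAdd t j) (by simp) (by simp)
    rw [glue_left] at this
    simpa using this
  have hdes : ∀ v, descentSet (glue (A, v, u)) = descentSet (glue (A, v0, u)) ↔
      descentSet v = (descentSet (glue (A, v0, u))).filter (· < t) := by
    intro v
    have hmid : ∀ v, t ∈ descentSet (glue (A, v, u)) ↔ 0 < t ∧ 0 < d := by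
      intro v
      rw [mem_descentSet]
      constructor
      · rintro ⟨h, h0, -⟩; omega
      · rintro ⟨h0, h1⟩
        refine ⟨by omega, h0, ?_⟩
        have e1 := glue_left A v u ⟨t - 1, by omega⟩
        have e2 := glue_right A v u ⟨0, h1⟩
        simp only [Fin.natAdd_mk, Fin.castAdd_mk, add_zero] at e1 e2
        rw [e1, e2]
        exact hA _ (Finset.orderEmbOfFin_mem _ _ _) _ (Finset.orderEmbOfFin_mem _ _ _)
    constructor
    · intro h
      rw [← h]
      ext i
      rw [Finset.mem_filter]
      constructor
      · intro hi
        have := (lt_of_mem_descentSet hi).2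
        exact ⟨(mem_des_glue_left A v u i this).2 hi, this⟩
      · rintro ⟨h1, h2⟩
        exact (mem_des_glue_left A v u i h2).1 h1
    · intro h
      ext i
      rcases lt_trichotomy i t with h1 | h1 | h1
      · rw [mem_des_glue_left A v u i h1, h, Finset.mem_filter]
        simp [h1]
      · subst h1
        rw [hmid, hmid]
      · obtain ⟨j, rfl⟩ := Nat.exists_eq_add_of_lt h1
        rw [add_assoc, mem_des_glue_right _ _ _ _ (by omega), mem_des_glue_right _ _ _ _ (by omega)]
  have htail : ∀ B v u', (∀ x, t < x → x ≤ t + d →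
      permApp (glue (t := t) (d := d) (B, v, u')) x = permApp (glue (A, v0, u)) x) ↔
      B = A ∧ u' = u := by
    intro B v u'
    have e : ∀ (w : Equiv.Perm (Fin (t + d))) (j : Fin d),
        permApp w (t + j + 1) = (w (Fin.natAdd t j) : ℕ) + 1 := by
      intro w j
      rw [permApp, dif_pos (by omega)]
      rfl
    constructor
    · intro h
      have h' : ∀ j : Fin d, glue (B, v, u') (Fin.natAdd t j) =
          glue (A, v0, u) (Fin.natAdd t j) := by
        intro j
        have := h (t + j + 1) (by omega) (by omega)
        rw [e, e] at this
        exact Fin.ext (by omega)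
      have hAB : B = A := by
        apply Subtype.ext
        apply compl_injective
        rw [glue_compl A v0 u, glue_compl B v u']
        simp only [h']
      refine ⟨hAB, ?_⟩
      subst hAB
      ext j
      have := h' j
      rw [glue_right, glue_right] at this
      rw [(Finset.orderEmbOfFin _ _).injective this]
    · rintro ⟨rfl, rfl⟩ x h1 h2
      obtain ⟨j, rfl⟩ := Nat.exists_eq_add_of_lt h1
      have e1 := e (glue (B, v, u')) ⟨j, by omega⟩
      have e2 := e (glue (B, v0, u')) ⟨j, by omega⟩
      rw [glue_right] at e1 e2
      simp only at e1 e2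
      rw [e1, e2]
  symm
  refine Finset.card_bij (fun v _ => glue (A, v, u)) ?_ ?_ ?_
  · intro v hv
    simp only [Finset.mem_univ, Finset.mem_filter, true_and] at hv ⊢
    exact ⟨(hdes v).2 hv, (htail _ _ _).2 ⟨rfl, rfl⟩⟩
  · intro v _ v' _ h
    have := glue_bijective.1 h
    simp only [Prod.mk.injEq] at this
    exact this.2.1
  · intro w hw
    obtain ⟨⟨B, v, u'⟩, rfl⟩ := glue_bijective.2 w
    simp only [Finset.mem_univ, Finset.mem_filter, true_and] at hw
    obtain ⟨rfl, rfl⟩ := (htail _ _ _).1 hw.2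
    refine ⟨v, ?_, rfl⟩
    simp only [Finset.mem_univ, Finset.mem_filter, true_and]
    exact (hdes v).1 hw.1

end glue


lemma swap_lt_iff {n : ℕ} (a b x y : Fin n) (hab : (b : ℕ) = a + 1)
    (h1 : ¬ (x = a ∧ y = b)) (h2 : ¬ (x = b ∧ y = a)) :
    Equiv.swap a b x < Equiv.swap a b y ↔ x < y := by
  simp only [Equiv.swap_apply_def, Fin.lt_def]
  simp only [Fin.ext_iff] at *
  split_ifs <;> omega

/-- the permutation of maximal length with given descent set is decreasing across blocks -/
lemma wS_cross {n : ℕ} (wS : Equiv.Perm (Fin n))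
    (hmax : ∀ v : Equiv.Perm (Fin n), descentSet v = descentSet wS → invCount v ≤ invCount wS) :
    ∀ s ∈ descentSet wS, ∀ i j : Fin n, (i : ℕ) < s → s ≤ (j : ℕ) → wS j < wS i := by
  have main : ∀ m : ℕ, ∀ i j : Fin n, (∃ s ∈ descentSet wS, (i : ℕ) < s ∧ s ≤ (j : ℕ)) →
      (wS j : ℕ) = wS i + m + 1 → False := by
    intro m
    induction m using Nat.strong_induction_on with
    | _ m ih =>
      rintro i j ⟨s, hs, his, hsj⟩ hm
      rcases Nat.eq_zero_or_pos m with h0 | h0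
      · subst h0
        have hab : (wS j : ℕ) = wS i + 1 := by omega
        let v : Equiv.Perm (Fin n) := wS.trans (Equiv.swap (wS i) (wS j))
        have hv : ∀ p q, ¬ (p = i ∧ q = j) → ¬ (p = j ∧ q = i) → (v p < v q ↔ wS p < wS q) := by
          intro p q h1 h2
          apply swap_lt_iff _ _ _ _ hab
          · simpa using h1
          · simpa using h2
        have hvd : descentSet v = descentSet wS := by
          ext k
          rw [mem_descentSet, mem_descentSet]
          refine exists_congr fun hk => exists_congr fun hk0 => ?_
          apply hv
          · rintro ⟨h1, h2⟩
            have e1 := congrArg Fin.val h1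
            have e2 := congrArg Fin.val h2
            simp only at e1 e2
            omega
          · rintro ⟨h1, h2⟩
            have e1 := congrArg Fin.val h1
            have e2 := congrArg Fin.val h2
            simp only at e1 e2
            have : s = k := by omega
            subst this
            rw [mem_descentSet] at hs
            obtain ⟨_, _, hlt⟩ := hs
            rw [h1, h2, Fin.lt_def] at hlt
            omega
        have := hmax v hvd
        apply absurd this
        rw [not_le]
        unfold invCount
        apply Finset.card_lt_card
        rw [Finset.ssubset_iff_of_subset]
        · refine ⟨(i, j), ?_, ?_⟩
          · simp only [Finset.mem_filter, Finset.mem_univ, true_and]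
            refine ⟨by rw [Fin.lt_def]; omega, ?_⟩
            simp only [v, Equiv.trans_apply, Equiv.swap_apply_left, Equiv.swap_apply_right]
            rw [Fin.lt_def]; omega
          · simp only [Finset.mem_filter, Finset.mem_univ, true_and]
            rintro ⟨_, h⟩
            rw [Fin.lt_def] at h
            omega
        · rintro ⟨p, q⟩ h
          simp only [Finset.mem_filter, Finset.mem_univ, true_and] at h ⊢
          refine ⟨h.1, ?_⟩
          rw [hv]
          · exact h.2
          · rintro ⟨rfl, rfl⟩
            have := h.1
            rw [Fin.lt_def] at this
            omega
          · rintro ⟨rfl, rfl⟩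
            have := h.2
            rw [Fin.lt_def] at this
            omega
      · let c : Fin n := ⟨wS i + 1, by have := (wS j).2; omega⟩
        let p := wS.symm c
        have hp : (wS p : ℕ) = wS i + 1 := by simp [p, c]
        by_cases hc : s ≤ (p : ℕ)
        · exact ih 0 h0 i p ⟨s, hs, his, hc⟩ (by omega)
        · exact ih (m - 1) (by omega) p j ⟨s, hs, by omega, hsj⟩ (by omega)
  intro s hs i j hi hj
  by_contra hc
  have hne : wS i ≠ wS j := fun h => by
    have := wS.injective h
    subst this
    omega
  have hlt : wS i < wS j := lt_of_le_of_ne (not_lt.1 hc) hne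
  rw [Fin.lt_def] at hlt
  exact main (wS j - wS i - 1) i j ⟨s, hs, hi, hj⟩ (by omega)

/-- number of colorings -/
lemma card_colorings (n r t : ℕ) [NeZero r] (ht : t ≤ n) :
    (Finset.univ.filter fun c : Fin n → ZMod r => ∀ k : Fin n, (k : ℕ) < t → c k = 0).card =
      r ^ (n - t) := by
  have : (Finset.univ.filter fun c : Fin n → ZMod r => ∀ k : Fin n, (k : ℕ) < t → c k = 0) =
      Fintype.piFinset fun k : Fin n => if (k : ℕ) < t then {0} else Finset.univ := by
    ext c
    simp only [Finset.mem_filter, Finset.mem_univ, true_and, Fintype.mem_piFinset]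
    refine forall_congr' fun k => ?_
    split_ifs with h <;> simp [h]
  rw [this, Fintype.card_piFinset]
  have e : ∀ k : Fin n, (if (k : ℕ) < t then ({0} : Finset (ZMod r)) else Finset.univ).card =
      if (k : ℕ) < t then 1 else r := by
    intro k; split_ifs <;> simp [ZMod.card]
  simp only [e]
  obtain ⟨d, rfl⟩ := Nat.exists_eq_add_of_le ht
  rw [Fin.prod_univ_add]
  simp

lemma card_zeroIncreasing (s t r : ℕ) [NeZero r] :
    (Finset.univ.filter fun p : Equiv.Perm (Fin (t + s)) × (Fin (t + s) → ZMod r) =>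
      zeroIncreasing p.1 p.2 t).card = (t + s).descFactorial s * r ^ s := by
  have : (Finset.univ.filter fun p : Equiv.Perm (Fin (t + s)) × (Fin (t + s) → ZMod r) =>
      zeroIncreasing p.1 p.2 t) =
      (Finset.univ.filter fun w : Equiv.Perm (Fin (t + s)) =>
        ∀ x y, 1 ≤ x → x < y → y ≤ t → permApp w x < permApp w y) ×ˢ
      (Finset.univ.filter fun c : Fin (t + s) → ZMod r => ∀ k : Fin (t + s), (k : ℕ) < t → c k = 0) := by
    ext ⟨w, c⟩
    simp only [Finset.mem_product, Finset.mem_filter, Finset.mem_univ, true_and]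
    rfl
  rw [this, Finset.card_product, card_increasing, card_colorings _ _ _ (by omega),
    Nat.add_sub_cancel_left, Nat.descFactorial_eq_factorial_mul_choose, mul_comm (s.factorial),
    Nat.choose_symm_add]


section words
variable {n r : ℕ}

noncomputable instance cInjFintype [NeZero r] : Fintype (CInjWord n r) :=
  haveI : Finite (CInjWord n r) := Finite.of_injective
    (fun x : CInjWord n r => (⟨x.1, List.Nodup.of_map _ x.2⟩ :
      {l : List (Fin n × ZMod r) // l.Nodup})) (fun x y h => Subtype.ext (by simpa using h))
  Fintype.ofFinite _

def wlen (x : CInjWord n r) : ℕ := x.1.length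

lemma wlen_le (x : CInjWord n r) : wlen x ≤ n := by
  have := x.2.length_le_card
  simpa [wlen] using this

lemma wlen_mono {x y : CInjWord n r} (h : x ≤ y) : wlen x ≤ wlen y := List.Sublist.length_le h

lemma eq_of_le_of_wlen {x y : CInjWord n r} (h : x ≤ y) (hl : wlen y ≤ wlen x) : x = y :=
  Subtype.ext (List.Sublist.eq_of_length_le h hl)

lemma wlen_bot : wlen (⊥ : CInjWord n r) = 0 := rfl

lemma eq_bot_of_wlen {x : CInjWord n r} (h : wlen x = 0) : x = ⊥ :=
  (eq_of_le_of_wlen bot_le (by rw [h]; exact Nat.zero_le _)).symm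

lemma le_of_comp {x y : CInjWord n r} (h : x ≤ y ∨ y ≤ x) (hl : wlen x ≤ wlen y) : x ≤ y := by
  rcases h with h | h
  · exact h
  · rw [eq_of_le_of_wlen h hl]

lemma list_interp {α : Type*} {a b : List α} (h : a.Sublist b) : ∀ j, a.length ≤ j →
    j ≤ b.length → ∃ y : List α, a.Sublist y ∧ y.Sublist b ∧ y.length = j := by
  induction h with
  | slnil => intro j _ hj; exact ⟨[], by simp, by simp, by simp at hj ⊢; omega⟩
  | @cons a b x h ih =>
    intro j h1 h2
    by_cases hj : j ≤ b.length
    · obtain ⟨y, e1, e2, e3⟩ := ih j h1 hj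
      exact ⟨y, e1, e2.cons _, e3⟩
    · refine ⟨x :: b, h.cons _, List.Sublist.refl _, ?_⟩
      simp at h2 ⊢; omega
  | @cons_cons a b x h ih =>
    intro j h1 h2
    simp only [List.length_cons] at h1 h2
    obtain ⟨y, e1, e2, e3⟩ := ih (j - 1) (by omega) (by omega)
    exact ⟨x :: y, e1.cons_cons _, e2.cons_cons _, by simp; omega⟩

lemma word_interp {a b : CInjWord n r} (h : a ≤ b) (j : ℕ) (h1 : wlen a ≤ j) (h2 : j ≤ wlen b) :
    ∃ y : CInjWord n r, a ≤ y ∧ y ≤ b ∧ wlen y = j := by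
  obtain ⟨y, e1, e2, e3⟩ := list_interp h j h1 h2
  exact ⟨⟨y, b.2.sublist (e2.map _)⟩, e1, e2, e3⟩

lemma word_extend (a : CInjWord n r) : ∃ b : CInjWord n r, a ≤ b ∧ wlen b = n := by
  let L : List (Fin n) := (List.finRange n).filter (fun i => i ∉ a.1.map Prod.fst)
  let l := a.1 ++ L.map (fun i => (i, (0 : ZMod r)))
  have hl : l.map Prod.fst = a.1.map Prod.fst ++ L := by
    simp [l, Function.comp_def]
  have hnd : (l.map Prod.fst).Nodup := by
    rw [hl, List.nodup_append]
    refine ⟨a.2, (List.nodup_finRange n).filter _, ?_⟩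
    intro x hx y hy hxy
    subst hxy
    have := (List.mem_filter.1 hy).2
    simp only [decide_eq_true_eq] at this
    exact this hx
  refine ⟨⟨l, hnd⟩, List.sublist_append_left _ _, ?_⟩
  have hu : (l.map Prod.fst).toFinset = Finset.univ := by
    rw [Finset.eq_univ_iff_forall]
    intro x
    rw [List.mem_toFinset, hl, List.mem_append]
    by_cases hx : x ∈ a.1.map Prod.fst
    · exact Or.inl hx
    · exact Or.inr (List.mem_filter.2 ⟨List.mem_finRange x, by simpa using hx⟩)
  have := List.toFinset_card_of_nodup hnd
  rw [hu] at this
  simp at this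
  simp [wlen, ← this]

lemma chain_comp {M : Set (CInjWord n r)} (hM : IsChain (· ≤ ·) M) {x y : CInjWord n r}
    (hx : x ∈ M) (hy : y ∈ M) : x ≤ y ∨ y ≤ x := hM.total hx hy

lemma exists_comparable [NeZero r] (M : Set (CInjWord n r)) (hM : IsChain (· ≤ ·) M) (j : ℕ)
    (hj : j ≤ n) : ∃ y : CInjWord n r, wlen y = j ∧ ∀ c ∈ M, c ≤ y ∨ y ≤ c := by
  let M' := insert ⊥ M
  have hM' : IsChain (· ≤ ·) M' := hM.insert fun b _ _ => Or.inl bot_le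
  obtain ⟨a, ⟨haM, haj⟩, ha⟩ := Set.exists_max_image {c ∈ M' | wlen c ≤ j} wlen (Set.toFinite _)
    ⟨⊥, Set.mem_insert _ _, by rw [wlen_bot]; omega⟩
  have ha' : ∀ c ∈ M, wlen c ≤ j → c ≤ a := fun c hc hcj =>
    le_of_comp (chain_comp hM' (Set.mem_insert_of_mem _ hc) haM)
      (ha c ⟨Set.mem_insert_of_mem _ hc, hcj⟩)
  have hb : ∃ b : CInjWord n r, a ≤ b ∧ j ≤ wlen b ∧ ∀ c ∈ M, j ≤ wlen c → b ≤ c := by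
    rcases Set.eq_empty_or_nonempty {c ∈ M' | j ≤ wlen c} with h | h
    · obtain ⟨b, hb1, hb2⟩ := word_extend a
      refine ⟨b, hb1, by omega, fun c hc hcj => ?_⟩
      have : c ∈ {c ∈ M' | j ≤ wlen c} := ⟨Set.mem_insert_of_mem _ hc, hcj⟩
      rw [h] at this
      exact absurd this (Set.notMem_empty _)
    · obtain ⟨b, ⟨hbM, hbj⟩, hb⟩ := Set.exists_min_image {c ∈ M' | j ≤ wlen c} wlen
        (Set.toFinite _) h
      refine ⟨b, le_of_comp (chain_comp hM' haM hbM) (haj.trans hbj), hbj, fun c hc hcj => ?_⟩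
      exact le_of_comp (chain_comp hM' hbM (Set.mem_insert_of_mem _ hc))
        (hb c ⟨Set.mem_insert_of_mem _ hc, hcj⟩)
  obtain ⟨b, hab, hjb, hb⟩ := hb
  obtain ⟨y, h1, h2, h3⟩ := word_interp hab j haj hjb
  refine ⟨y, h3, fun c hc => ?_⟩
  rcases le_total (wlen c) j with h | h
  · exact Or.inl ((ha' c hc h).trans h1)
  · exact Or.inr (h2.trans (hb c hc h))

/-- chains with prescribed rank set below `x` -/
noncomputable def XF [NeZero r] (T : Finset ℕ) (x : WithTop (CInjWord n r)) :
    Finset (Finset (CInjWord n r)) :=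
  Finset.univ.filter fun C => IsChain (· ≤ ·) (C : Set (CInjWord n r)) ∧ C.image wlen = T ∧
    ∀ c ∈ C, (c : WithTop (CInjWord n r)) ≤ x

lemma mem_XF [NeZero r] {T : Finset ℕ} {x : WithTop (CInjWord n r)}
    {C : Finset (CInjWord n r)} : C ∈ XF T x ↔
    IsChain (· ≤ ·) (C : Set (CInjWord n r)) ∧ C.image wlen = T ∧
    ∀ c ∈ C, (c : WithTop (CInjWord n r)) ≤ x := by
  simp [XF]

lemma XF_empty [NeZero r] (x : WithTop (CInjWord n r)) : (XF ∅ x).card = 1 := by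
  rw [Finset.card_eq_one]
  refine ⟨∅, ?_⟩
  ext C
  rw [mem_XF, Finset.mem_singleton]
  constructor
  · rintro ⟨_, h, _⟩
    exact Finset.image_eq_empty.1 h
  · rintro rfl
    simp

lemma XF_insert [NeZero r] (T : Finset ℕ) (t : ℕ) (hT : ∀ s ∈ T, s < t)
    (x : WithTop (CInjWord n r)) :
    XF (insert t T) x = (Finset.univ.filter fun y : CInjWord n r =>
      (y : WithTop (CInjWord n r)) ≤ x ∧ wlen y = t).biUnion
        fun y => (XF T (y : WithTop (CInjWord n r))).image (insert y) := by
  ext C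
  rw [Finset.mem_biUnion, mem_XF]
  constructor
  · rintro ⟨h1, h2, h3⟩
    have : t ∈ C.image wlen := by rw [h2]; simp
    obtain ⟨y, hy, hyt⟩ := Finset.mem_image.1 this
    refine ⟨y, by simp [h3 y hy, hyt], ?_⟩
    rw [Finset.mem_image]
    have hlen : ∀ c ∈ C.erase y, wlen c ∈ T := by
      intro c hc
      have hc' := Finset.mem_of_mem_erase hc
      have : wlen c ∈ insert t T := by rw [← h2]; exact Finset.mem_image_of_mem _ hc'
      rcases Finset.mem_insert.1 this with h | h
      · exfalso
        refine Finset.ne_of_mem_erase hc ?_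
        exact eq_of_le_of_wlen (le_of_comp (chain_comp h1 hc' hy) (by omega)) (by omega)
      · exact h
    refine ⟨C.erase y, ?_, Finset.insert_erase hy⟩
    rw [mem_XF]
    refine ⟨h1.mono (by simp), ?_, ?_⟩
    · ext s
      rw [Finset.mem_image]
      constructor
      · rintro ⟨c, hc, rfl⟩
        exact hlen c hc
      · intro hs
        have : s ∈ C.image wlen := by rw [h2]; simp [hs]
        obtain ⟨c, hc, hcs⟩ := Finset.mem_image.1 this
        refine ⟨c, Finset.mem_erase.2 ⟨?_, hc⟩, hcs⟩
        rintro rfl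
        have := hT s hs
        omega
    · intro c hc
      rw [WithTop.coe_le_coe]
      refine le_of_comp (chain_comp h1 (Finset.mem_of_mem_erase hc) hy) ?_
      have := hT _ (hlen c hc)
      omega
  · rintro ⟨y, hy, hC0⟩
    obtain ⟨C, hC, rfl⟩ := Finset.mem_image.1 hC0
    simp only [Finset.mem_filter, Finset.mem_univ, true_and] at hy
    rw [mem_XF] at hC
    obtain ⟨h1, h2, h3⟩ := hC
    refine ⟨?_, ?_, ?_⟩
    · rw [Finset.coe_insert]
      exact h1.insert fun b hb _ => Or.inr (WithTop.coe_le_coe.1 (h3 b hb))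
    · rw [Finset.image_insert, h2, hy.2]
    · intro c hc
      rcases Finset.mem_insert.1 hc with rfl | hc
      · exact hy.1
      · exact (h3 c hc).trans hy.1

lemma XF_insert_card [NeZero r] (T : Finset ℕ) (t : ℕ) (hT : ∀ s ∈ T, s < t)
    (x : WithTop (CInjWord n r)) (k : ℕ)
    (hk : ∀ y : CInjWord n r, wlen y = t → (XF T (y : WithTop (CInjWord n r))).card = k) :
    (XF (insert t T) x).card = (Finset.univ.filter fun y : CInjWord n r =>
      (y : WithTop (CInjWord n r)) ≤ x ∧ wlen y = t).card * k := by
  have hnot : ∀ y : CInjWord n r, wlen y = t → ∀ z, ∀ C ∈ XF T z, y ∉ C := by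
    intro y hy z C hC hyC
    rw [mem_XF] at hC
    have : wlen y ∈ T := by rw [← hC.2.1]; exact Finset.mem_image_of_mem _ hyC
    have := hT _ this
    omega
  rw [XF_insert T t hT, Finset.card_biUnion, Finset.sum_const_nat (m := k)]
  · intro y hy
    simp only [Finset.mem_filter, Finset.mem_univ, true_and] at hy
    rw [Finset.card_image_of_injOn, hk y hy.2]
    intro C hC D hD h
    have h1 := hnot y hy.2 _ C hC
    have h2 := hnot y hy.2 _ D hD
    rw [← Finset.erase_insert h1, ← Finset.erase_insert h2]
    exact congrArg (fun E => Finset.erase E y) h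
  · intro y hy z hz hyz
    simp only [Finset.coe_filter, Finset.mem_univ, true_and, Set.mem_ofPred_eq] at hy hz
    refine Finset.disjoint_left.2 ?_
    intro E hE hE'
    obtain ⟨C, hC, rfl⟩ := Finset.mem_image.1 hE
    obtain ⟨D, hD, hDC⟩ := Finset.mem_image.1 hE'
    have : z ∈ insert y C := by rw [← hDC]; simp
    rcases Finset.mem_insert.1 this with h | h
    · exact hyz h.symm
    · exact hnot z hz.2 _ C hC h

lemma card_below [NeZero r] (x : CInjWord n r) (t : ℕ) :
    (Finset.univ.filter fun y : CInjWord n r =>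
      (y : WithTop (CInjWord n r)) ≤ (x : WithTop (CInjWord n r)) ∧ wlen y = t).card =
    (wlen x).choose t := by
  have hx : x.1.Nodup := List.Nodup.of_map _ x.2
  rw [wlen, ← List.length_sublistsLen, ← List.toFinset_card_of_nodup
    (List.nodup_sublistsLen t hx)]
  refine Finset.card_bij (fun y _ => y.1) ?_ ?_ ?_
  · intro y hy
    simp only [Finset.mem_filter, Finset.mem_univ, true_and, WithTop.coe_le_coe] at hy
    rw [List.mem_toFinset, List.mem_sublistsLen]
    exact hy
  · intro y _ z _ h
    exact Subtype.ext h
  · intro l hl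
    rw [List.mem_toFinset, List.mem_sublistsLen] at hl
    exact ⟨(⟨l, x.2.sublist (hl.1.map _)⟩ : CInjWord n r),
      Finset.mem_filter.2 ⟨Finset.mem_univ _, WithTop.coe_le_coe.2 hl.1, hl.2⟩, rfl⟩

lemma card_words [NeZero r] (t : ℕ) :
    (Finset.univ.filter fun y : CInjWord n r =>
      (y : WithTop (CInjWord n r)) ≤ ⊤ ∧ wlen y = t).card = n.descFactorial t * r ^ t := by
  have : n.descFactorial t * r ^ t =
      (Finset.univ : Finset ((Fin t ↪ Fin n) × (Fin t → ZMod r))).card := by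
    simp [Fintype.card_embedding_eq, ZMod.card]
  rw [this]
  symm
  have hm : ∀ p : (Fin t ↪ Fin n) × (Fin t → ZMod r),
      ((List.ofFn fun i => (p.1 i, p.2 i)).map Prod.fst).Nodup := by
    intro p
    rw [List.map_ofFn, List.nodup_ofFn]
    exact p.1.injective
  refine Finset.card_bij (fun p _ => (⟨List.ofFn fun i => (p.1 i, p.2 i), hm p⟩ :
    CInjWord n r)) ?_ ?_ ?_
  · intro p _
    exact Finset.mem_filter.2 ⟨Finset.mem_univ _, le_top, List.length_ofFn⟩
  · rintro ⟨f, c⟩ _ ⟨f', c'⟩ _ h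
    have h1 := List.ofFn_injective (congrArg Subtype.val h)
    have h2 : ∀ i, f i = f' i ∧ c i = c' i := fun i => by simpa using congrFun h1 i
    ext i
    · simp [(h2 i).1]
    · simp [(h2 i).2]
  · intro y hy
    simp only [Finset.mem_filter, Finset.mem_univ, true_and] at hy
    have hy := hy.2
    unfold wlen at hy
    subst hy
    refine ⟨(⟨fun i => (y.1.get i).1, ?_⟩, fun i => (y.1.get i).2), Finset.mem_univ _, ?_⟩
    · intro i j h
      have := List.nodup_iff_injective_get.1 y.2
      have h2 := @this ⟨i, by simp⟩ ⟨j, by simp⟩ (by simpa using h)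
      simpa [Fin.ext_iff] using h2
    · apply Subtype.ext
      simp

lemma XF_word [NeZero r] (T : Finset ℕ) : ∀ x : CInjWord n r, (∀ s ∈ T, s ≤ wlen x) →
    (XF T (x : WithTop (CInjWord n r))).card = numSub (wlen x) T := by
  induction T using Finset.induction_on_max with
  | empty => intro x _; rw [XF_empty, numSub_empty]
  | insert t T ht ih =>
    intro x hx
    rw [XF_insert_card T t ht _ (numSub t T), card_below]
    · obtain ⟨d, hd⟩ := Nat.exists_eq_add_of_le (hx t (by simp))
      rw [hd, numSub_insert T ht]
    · rintro y rfl
      exact ih y fun s hs => (ht s hs).le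

lemma XF_top [NeZero r] (T : Finset ℕ) (t : ℕ) (ht : ∀ s ∈ T, s < t) :
    (XF (insert t T) (⊤ : WithTop (CInjWord n r))).card =
      n.descFactorial t * r ^ t * numSub t T := by
  rw [XF_insert_card T t ht _ (numSub t T), card_words]
  rintro y rfl
  exact XF_word T y fun s hs => (ht s hs).le

lemma rkC_coe (x : CInjWord n r) : rkC n r (x : WithTop (CInjWord n r)) = wlen x := rfl

lemma rkC_top : rkC n r ⊤ = n + 1 := rfl

lemma chainCount_eq [NeZero r] (T : Finset ℕ) (hT : ∀ s ∈ T, 0 < s ∧ s ≤ n) :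
    chainCount (rkC n r) T = (XF T (⊤ : WithTop (CInjWord n r))).card := by
  let φ : Finset (CInjWord n r) → Set (WithTop (CInjWord n r)) :=
    fun C => (fun c : CInjWord n r => (c : WithTop (CInjWord n r))) '' (C : Set _) ∪ {⊥, ⊤}
  have hbot : ∀ C ∈ XF T (⊤ : WithTop (CInjWord n r)), (⊥ : CInjWord n r) ∉ C := by
    intro C hC h
    rw [mem_XF] at hC
    have : wlen (⊥ : CInjWord n r) ∈ T := by rw [← hC.2.1]; exact Finset.mem_image_of_mem _ h
    have := (hT _ this).1
    rw [wlen_bot] at this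
    omega
  have hcoe : ∀ (C : Finset (CInjWord n r)) (c : CInjWord n r),
      (c : WithTop (CInjWord n r)) ∈ φ C ↔ c ∈ C ∨ c = ⊥ := by
    intro C c
    simp only [φ, Set.mem_union, Set.mem_image, Finset.mem_coe, WithTop.coe_inj, exists_eq_right,
      Set.mem_insert_iff, Set.mem_singleton_iff, WithTop.coe_ne_top, or_false]
    rw [← WithTop.coe_bot, WithTop.coe_inj]
  have himg : maxChainsIn (rankSel (rkC n r) T) =
      φ '' (XF T (⊤ : WithTop (CInjWord n r)) : Set (Finset (CInjWord n r))) := by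
    ext M
    rw [Set.mem_image]
    constructor
    · rintro ⟨h1, h2, h3⟩
      have hb : (⊥ : WithTop (CInjWord n r)) ∈ M := by
        have := h3 (insert ⊥ M) (Set.insert_subset (by simp [rankSel]) h1)
          (h2.insert fun b _ _ => Or.inl bot_le) (Set.subset_insert _ _)
        rw [this]; exact Set.mem_insert _ _
      have ht : (⊤ : WithTop (CInjWord n r)) ∈ M := by
        have := h3 (insert ⊤ M) (Set.insert_subset (by simp [rankSel]) h1)
          (h2.insert fun b _ _ => Or.inr le_top) (Set.subset_insert _ _)
        rw [this]; exact Set.mem_insert _ _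
      let M0 : Set (CInjWord n r) := {c | (c : WithTop (CInjWord n r)) ∈ M}
      have hM0 : IsChain (· ≤ ·) M0 := by
        intro a ha b hb hab
        have := h2 ha hb (by simpa using hab)
        simpa using this
      let C : Finset (CInjWord n r) := Finset.univ.filter fun c => c ∈ M0 ∧ c ≠ ⊥
      have hC : ∀ c, c ∈ C ↔ (c : WithTop (CInjWord n r)) ∈ M ∧ c ≠ ⊥ := by
        intro c; simp [C, M0]
      refine ⟨C, ?_, ?_⟩
      · rw [Finset.mem_coe, mem_XF]
        refine ⟨hM0.mono fun c hc => ((hC c).1 hc).1, ?_, fun _ _ => le_top⟩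
        ext s
        rw [Finset.mem_image]
        constructor
        · rintro ⟨c, hc, rfl⟩
          obtain ⟨hc1, hc2⟩ := (hC c).1 hc
          have := h1 hc1
          simp only [rankSel, Set.mem_union, Set.mem_ofPred_eq, rkC_coe, Set.mem_insert_iff,
            Set.mem_singleton_iff, WithTop.coe_ne_top, or_false] at this
          rcases this with h | h
          · exact h
          · exact absurd (WithTop.coe_inj.1 h) hc2
        · intro hs
          obtain ⟨y, hy1, hy2⟩ := exists_comparable M0 hM0 s (hT s hs).2
          have hyM : (y : WithTop (CInjWord n r)) ∈ M := by
            have := h3 (insert (y : WithTop (CInjWord n r)) M)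
              (Set.insert_subset (Or.inl (by
                show rkC n r (y : WithTop (CInjWord n r)) ∈ T
                rw [rkC_coe, hy1]; exact hs)) h1)
              (h2.insert fun b hb _ => by
                induction b using WithTop.recTopCoe with
                | top => exact Or.inl le_top
                | coe b =>
                  have := hy2 b hb
                  rw [WithTop.coe_le_coe, WithTop.coe_le_coe]
                  exact this.symm) (Set.subset_insert _ _)
            rw [this]; exact Set.mem_insert _ _
          refine ⟨y, (hC y).2 ⟨hyM, ?_⟩, hy1⟩
          rintro rfl
          rw [wlen_bot] at hy1
          have := (hT s hs).1
          omega
      · ext x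
        induction x using WithTop.recTopCoe with
        | top => simp [φ, ht]
        | coe c =>
          rw [hcoe, hC]
          by_cases hc : c = ⊥
          · subst hc
            simpa using hb
          · simp [hc]
    · rintro ⟨C, hC, rfl⟩
      have hC' := mem_XF.1 (Finset.mem_coe.1 hC)
      obtain ⟨h1, h2, -⟩ := hC'
      refine ⟨?_, ?_, ?_⟩
      · rintro x (⟨c, hc, rfl⟩ | hx)
        · left
          show rkC n r (c : WithTop (CInjWord n r)) ∈ T
          rw [rkC_coe, ← h2]
          exact Finset.mem_image_of_mem _ hc
        · exact Or.inr hx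
      · intro x hx y hy _
        induction x using WithTop.recTopCoe with
        | top => exact Or.inr le_top
        | coe a =>
          induction y using WithTop.recTopCoe with
          | top => exact Or.inl le_top
          | coe b =>
            rw [hcoe] at hx hy
            show (a : WithTop (CInjWord n r)) ≤ b ∨ (b : WithTop (CInjWord n r)) ≤ a
            rw [WithTop.coe_le_coe, WithTop.coe_le_coe]
            rcases hx with hx | rfl
            · rcases hy with hy | rfl
              · exact chain_comp h1 hx hy
              · exact Or.inr bot_le
            · exact Or.inl bot_le
      · intro D hD hDc hCD
        refine Set.Subset.antisymm hCD ?_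
        intro x hx
        rcases hD hx with h | h
        · induction x using WithTop.recTopCoe with
          | top => simp [φ]
          | coe w =>
            have h : rkC n r (w : WithTop (CInjWord n r)) ∈ T := h
            rw [rkC_coe, ← h2] at h
            obtain ⟨c, hc, hcw⟩ := Finset.mem_image.1 h
            have hcD : (c : WithTop (CInjWord n r)) ∈ D := hCD ((hcoe C c).2 (Or.inl hc))
            have hcomp : c ≤ w ∨ w ≤ c := by
              have := hDc.total hcD hx
              rw [WithTop.coe_le_coe, WithTop.coe_le_coe] at this
              exact this
            have : c = w := eq_of_le_of_wlen (le_of_comp hcomp (by omega)) (by omega)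
            rw [hcoe, ← this]
            exact Or.inl hc
        · exact Or.inr h
  unfold chainCount
  rw [himg, Set.InjOn.ncard_image, Set.ncard_coe_finset]
  intro C hC D hD h
  have e : ∀ c, c ∈ C ∨ c = ⊥ ↔ c ∈ D ∨ c = ⊥ := by
    intro c
    rw [← hcoe, ← hcoe, h]
  ext c
  by_cases hc : c = ⊥
  · subst hc
    exact iff_of_false (hbot C hC) (hbot D hD)
  · have := e c
    simpa [hc] using this

end words


lemma sElt_mem (n : ℕ) (S : Finset ℕ) (j : ℕ) :
    sElt n S j = 0 ∨ sElt n S j ∈ S ∨ sElt n S j = n := by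
  unfold sElt
  split_ifs with h0 h1
  · exact Or.inl rfl
  · right; left
    rw [List.getD_eq_getElem _ _ (by simp; omega), ← Finset.mem_sort (· ≤ ·)]
    exact List.getElem_mem _
  · exact Or.inr (Or.inr rfl)

lemma sElt_mono (n : ℕ) (S : Finset ℕ) (hS : ∀ x ∈ S, x ≤ n) {i j : ℕ} (hij : i ≤ j) :
    sElt n S i ≤ sElt n S j := by
  unfold sElt
  by_cases hi : i = 0
  · simp [hi]
  rw [if_neg hi, if_neg (show j ≠ 0 by omega)]
  by_cases hj : j ≤ S.card
  · rw [if_pos (hij.trans hj), if_pos hj, List.getD_eq_getElem _ _ (by simp; omega),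
      List.getD_eq_getElem _ _ (by simp; omega)]
    exact (S.pairwise_sort (· ≤ ·)).sortedLE.getElem_le_getElem_of_le (by omega)
  · rw [if_neg hj]
    split_ifs with h
    · rw [List.getD_eq_getElem _ _ (by simp; omega)]
      refine hS _ ?_
      rw [← Finset.mem_sort (· ≤ ·)]
      exact List.getElem_mem _
    · exact le_refl _

lemma bDim_rec (n r : ℕ) [NeZero r] (t : ℕ) (S : Finset ℕ) (ht : 0 < t) (htn : t ≤ n)
    (hS : ∀ x ∈ S, 0 < x ∧ x < t) :
    bDim (rkC n r) (insert t S) =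
      ((n.descFactorial t * r ^ t : ℕ) : ℤ) * (numEq t S : ℤ) - bDim (rkC n r) S := by
  unfold bDim
  rw [altSum_insert _ t S (fun h => lt_irrefl _ (hS t h).2)]
  congr 1
  rw [← moebius_num, Finset.mul_sum]
  refine Finset.sum_congr rfl fun T hT => ?_
  have hT' := Finset.mem_powerset.1 hT
  rw [chainCount_eq, XF_top T t fun s hs => (hS s (hT' hs)).2]
  · push_cast; ring
  · intro s hs
    rcases Finset.mem_insert.1 hs with rfl | h
    · exact ⟨ht, htn⟩
    · have := hS s (hT' h)
      omega

lemma bDim_empty (n r : ℕ) [NeZero r] : bDim (rkC n r) ∅ = 1 := by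
  unfold bDim
  rw [Finset.powerset_empty, Finset.sum_singleton, chainCount_eq _ (by simp), XF_empty]
  simp

lemma numEq_zero : numEq 0 ∅ = 1 := by
  unfold numEq
  rw [Finset.card_eq_one]
  refine ⟨1, ?_⟩
  ext w
  simp [descentSet_empty_iff]

/-- the condition defining `tauU` -/
def tauCond (n : ℕ) {r : ℕ} (S : Finset ℕ) (wS : Equiv.Perm (Fin n))
    (p : Equiv.Perm (Fin n) × Equiv.Perm (Fin n) × (Fin n → ZMod r)) (i : ℕ) : Prop :=
  (∀ x, sElt n S (S.card + 1 - i) < x → x ≤ n → permApp p.1 x = permApp wS x) ∧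
      zeroIncreasing p.2.1 p.2.2 (n - sElt n S (S.card + 1 - i))

lemma tauCond_anti (n : ℕ) {r : ℕ} (S : Finset ℕ) (hS : ∀ x ∈ S, x ≤ n) (wS : Equiv.Perm (Fin n))
    (p : Equiv.Perm (Fin n) × Equiv.Perm (Fin n) × (Fin n → ZMod r)) {i j : ℕ} (hij : i ≤ j)
    (h : tauCond n S wS p j) : tauCond n S wS p i := by
  have hm : sElt n S (S.card + 1 - j) ≤ sElt n S (S.card + 1 - i) :=
    sElt_mono n S hS (by omega)
  refine ⟨fun x hx hxn => h.1 x (by omega) hxn, fun x y hx hxy hy => h.2.1 x y hx hxy (by omega),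
    fun k hk => h.2.2 k (by omega)⟩

lemma tauCond_iff (n : ℕ) {r : ℕ} (S : Finset ℕ) (hS : ∀ x ∈ S, x ≤ n) (wS : Equiv.Perm (Fin n))
    (p : Equiv.Perm (Fin n) × Equiv.Perm (Fin n) × (Fin n → ZMod r)) (i : ℕ)
    (hi : i < S.card + 2) :
    tauCond n S wS p i ↔ i ≤ tauU n S wS p.1 p.2.1 p.2.2 := by
  constructor
  · intro h
    unfold tauU
    refine Finset.le_max' _ _ ?_
    rw [Finset.mem_filter]
    exact ⟨Finset.mem_range.2 hi, h⟩
  · intro h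
    refine tauCond_anti n S hS wS p h ?_
    unfold tauU
    exact (Finset.mem_filter.1 (Finset.max'_mem _ _)).2

lemma tauU_lt (n : ℕ) {r : ℕ} (S : Finset ℕ) (wS : Equiv.Perm (Fin n))
    (p : Equiv.Perm (Fin n) × Equiv.Perm (Fin n) × (Fin n → ZMod r)) :
    tauU n S wS p.1 p.2.1 p.2.2 < S.card + 2 := by
  unfold tauU
  exact Finset.mem_range.1 (Finset.mem_filter.1 (Finset.max'_mem _ _)).1

lemma even_indicator (m k : ℕ) (h : m < k) :
    ∑ i ∈ Finset.range k, (-1 : ℤ) ^ i * (if i ≤ m then 1 else 0) = if Even m then 1 else 0 := by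
  have h1 : ∀ m, ∑ i ∈ Finset.range (m + 1), (-1 : ℤ) ^ i = if Even m then 1 else 0 := by
    intro m
    induction m with
    | zero => simp
    | succ m ih =>
      rw [Finset.sum_range_succ, ih]
      rcases Nat.even_or_odd m with he | ho
      · have : ¬ Even (m + 1) := by simpa [Nat.even_add_one] using he
        rw [if_pos he, if_neg this, (Nat.not_even_iff_odd.1 this).neg_one_pow]; rfl
      · have h2 : Even (m + 1) := ho.add_one
        rw [if_neg (Nat.not_even_iff_odd.2 ho), if_pos h2, h2.neg_one_pow]; rfl
  rw [← h1]
  simp only [mul_ite, mul_one, mul_zero]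
  rw [← Finset.sum_filter]
  refine Finset.sum_congr ?_ fun _ _ => rfl
  ext i
  simp only [Finset.mem_filter, Finset.mem_range]
  omega

lemma card_cond (n r : ℕ) [NeZero r] (S : Finset ℕ) (hS : ∀ x ∈ S, x ≤ n)
    (wS : Equiv.Perm (Fin n)) (hwS : descentSet wS = S)
    (hwSmax : ∀ v : Equiv.Perm (Fin n), descentSet v = S → invCount v ≤ invCount wS) (i : ℕ) :
    (Finset.univ.filter fun p : Equiv.Perm (Fin n) × Equiv.Perm (Fin n) × (Fin n → ZMod r) =>
      descentSet p.1 = S ∧ tauCond n S wS p i).card =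
    n.descFactorial (sElt n S (S.card + 1 - i)) * r ^ (sElt n S (S.card + 1 - i)) *
      numEq (sElt n S (S.card + 1 - i)) (S.filter (· < sElt n S (S.card + 1 - i))) := by
  have hs : sElt n S (S.card + 1 - i) ≤ n := by
    rcases sElt_mem n S (S.card + 1 - i) with h | h | h
    · omega
    · exact hS _ h
    · omega
  have hcr : ∀ a b : Fin n, (a : ℕ) < sElt n S (S.card + 1 - i) →
      sElt n S (S.card + 1 - i) ≤ (b : ℕ) → wS b < wS a := by
    intro a b ha hb
    rcases sElt_mem n S (S.card + 1 - i) with h | h | h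
    · omega
    · rw [← hwS] at h
      rw [hwS] at h
      exact wS_cross wS (fun v hv => hwSmax v (hv.trans hwS)) _ (by rw [hwS]; exact h) a b ha hb
    · omega
  unfold tauCond
  generalize sElt n S (S.card + 1 - i) = s at *
  have hprod : (Finset.univ.filter fun p : Equiv.Perm (Fin n) × Equiv.Perm (Fin n) ×
        (Fin n → ZMod r) => descentSet p.1 = S ∧
        (∀ x, s < x → x ≤ n → permApp p.1 x = permApp wS x) ∧
          zeroIncreasing p.2.1 p.2.2 (n - s)) =
      (Finset.univ.filter fun w : Equiv.Perm (Fin n) => descentSet w = S ∧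
        ∀ x, s < x → x ≤ n → permApp w x = permApp wS x) ×ˢ
      (Finset.univ.filter fun p : Equiv.Perm (Fin n) × (Fin n → ZMod r) =>
        zeroIncreasing p.1 p.2 (n - s)) := by
    ext ⟨w, π, c⟩
    simp only [Finset.mem_product, Finset.mem_filter, Finset.mem_univ, true_and]
    tauto
  refine (Eq.trans (by congr!) (congrArg Finset.card hprod)).trans ?_
  rw [Finset.card_product]
  have e1 : (Finset.univ.filter fun p : Equiv.Perm (Fin n) × (Fin n → ZMod r) =>
        zeroIncreasing p.1 p.2 (n - s)).card = n.descFactorial s * r ^ s := by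
    obtain ⟨d, rfl⟩ := Nat.exists_eq_add_of_le' hs
    rw [Nat.add_sub_cancel]
    exact card_zeroIncreasing s d r
  have e2 : (Finset.univ.filter fun w : Equiv.Perm (Fin n) => descentSet w = S ∧
        ∀ x, s < x → x ≤ n → permApp w x = permApp wS x).card =
      numEq s (S.filter (· < s)) := by
    obtain ⟨d, rfl⟩ := Nat.exists_eq_add_of_le hs
    subst hwS
    exact card_tail wS hcr
  rw [e1, e2, mul_comm]


/-- **Corollary 4.6(b)**: `b_P(S ∪ {n})` equals the number of pairs `(w,u)` with
`w ∈ 𝔖_n` of descent set `S` and `u` an `r`-colored permutation with `τ(w,u)` even. -/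
theorem statement17 (n r : ℕ) (hn : 0 < n) (hr : 0 < r)
    (S : Finset ℕ) (hS : S ⊆ Finset.Icc 1 (n - 1))
    (wS : Equiv.Perm (Fin n)) (hwS : descentSet wS = S)
    (hwSmax : ∀ v : Equiv.Perm (Fin n), descentSet v = S → invCount v ≤ invCount wS) :
    cChainDim n r (insert n S) =
      (Nat.card {p : Equiv.Perm (Fin n) × Equiv.Perm (Fin n) × (Fin n → ZMod r) //
          descentSet p.1 = S ∧ Even (tauU n S wS p.1 p.2.1 p.2.2)} : ℤ) := by
  haveI : NeZero r := ⟨by omega⟩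
  have hS' : ∀ x ∈ S, 0 < x ∧ x < n := by
    intro x hx
    have := Finset.mem_Icc.1 (hS hx)
    omega
  have hSn : ∀ x ∈ S, x ≤ n := fun x hx => (hS' x hx).2.le
  unfold cChainDim
  rw [bsum_eq (fun t => ((n.descFactorial t * r ^ t : ℕ) : ℤ)) (fun t T => (numEq t T : ℤ))
    (bDim (rkC n r)) (by simp) (by rw [numEq_zero]; rfl) (bDim_empty n r) n
    (fun t S h0 h1 h2 => bDim_rec n r t S h0 h1 h2) S n hn le_rfl hS']
  have hterm : ∀ i, ((n.descFactorial (sElt n S (S.card + 1 - i)) *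
      r ^ (sElt n S (S.card + 1 - i)) : ℕ) : ℤ) *
      (numEq (sElt n S (S.card + 1 - i)) (S.filter (· < sElt n S (S.card + 1 - i))) : ℤ) =
      ∑ p : Equiv.Perm (Fin n) × Equiv.Perm (Fin n) × (Fin n → ZMod r),
        if descentSet p.1 = S ∧ tauCond n S wS p i then 1 else 0 := by
    intro i
    rw [← Nat.cast_mul, ← card_cond n r S hSn wS hwS hwSmax i, Finset.card_filter]
    push_cast
    rfl
  rw [Nat.card_eq_fintype_card, Fintype.card_subtype, Finset.card_filter]
  push_cast
  have h1 : ∀ i ∈ Finset.range (S.card + 2), (-1 : ℤ) ^ i *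
      (((n.descFactorial (sElt n S (S.card + 1 - i)) *
      r ^ (sElt n S (S.card + 1 - i)) : ℕ) : ℤ) *
      (numEq (sElt n S (S.card + 1 - i)) (S.filter (· < sElt n S (S.card + 1 - i))) : ℤ)) =
      ∑ p : Equiv.Perm (Fin n) × Equiv.Perm (Fin n) × (Fin n → ZMod r),
        (-1 : ℤ) ^ i * if descentSet p.1 = S ∧ tauCond n S wS p i then 1 else 0 := by
    intro i _
    rw [hterm, Finset.mul_sum]
  push_cast at h1
  rw [Finset.sum_congr rfl h1, Finset.sum_comm]
  refine Finset.sum_congr rfl fun p _ => ?_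
  by_cases hp : descentSet p.1 = S
  · simp only [hp, true_and]
    rw [← even_indicator _ _ (tauU_lt n S wS p)]
    refine Finset.sum_congr rfl fun i hi => ?_
    simp only [tauCond_iff n S hSn wS p i (Finset.mem_range.1 hi)]
  · simp [hp]
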